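/- arXiv:2001.06470 — 2 statements merged into one kernel-verified Lean document; each statement's English description precedes it below -/
import Mathlib

section
/- Let A be a matrix obtained from a Fiedler companion matrix F_{i_1,…,i_n} by changing some zero entries lying below the superdiagonal to nonzero constants. Then A is a companion matrix if and only if all the changed entries lie in the i_1-block (the submatrix with rows i_1,…,n and columns 1,…,i_1) and s_{k−1}(A) = x_k for every k = 1,…,n. -/
open Polynomial Matrix

noncomputable section

/-- A square matrix is *unit lower Hessenberg* (ULH): every entry on the
superdiagonal equals `1` and every entry above the superdiagonal equals `0`. -/
def IsULH {R : Type*} [Zero R] [One R] {m : ℕ} (A : Matrix (Fin m) (Fin m) R) : Prop :=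
  (∀ i j : Fin m, (j : ℕ) = (i : ℕ) + 1 → A i j = 1) ∧
  (∀ i j : Fin m, (i : ℕ) + 1 < (j : ℕ) → A i j = 0)

/-- The total order `≺` on positions: `(i,j) ≺ (i',j')` iff `i−j < i'−j'`, or
`i−j = i'−j'` and `i < i'`. -/
def Prec {m : ℕ} (a b : Fin m × Fin m) : Prop :=
  ((a.1 : ℕ) - (a.2 : ℕ) < (b.1 : ℕ) - (b.2 : ℕ)) ∨
  ((a.1 : ℕ) - (a.2 : ℕ) = (b.1 : ℕ) - (b.2 : ℕ) ∧ (a.1 : ℕ) < (b.1 : ℕ))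

/-- `pos` is a valid family of variable positions for a matrix of `ℋ`:
each position is on or below the main diagonal, and the positions are
strictly increasing in the order `≺`. -/
def IsHPos {m : ℕ} (pos : Fin m → Fin m × Fin m) : Prop :=
  (∀ k, ((pos k).2 : ℕ) ≤ ((pos k).1 : ℕ)) ∧
  (∀ k l : Fin m, k < l → Prec (pos k) (pos l))

/-- `pos` is a valid family of variable positions for a matrix of `ℬ`:
in addition all variables lie in a common `t`-block, i.e.
`max j_k ≤ min i_k`. -/
def IsBPos {m : ℕ} (pos : Fin m → Fin m × Fin m) : Prop :=
  IsHPos pos ∧ ∀ k l : Fin m, ((pos k).2 : ℕ) ≤ ((pos l).1 : ℕ)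

/-- The ULH matrix `H_{(i₁,j₁),…,(iₙ,jₙ)}` with `2n−1` nonzero entries: ones on the
superdiagonal and the variable `xₖ` at position `pos k` (0-indexed). -/
def HMat (F : Type*) [Field F] {n : ℕ} (pos : Fin n → Fin n × Fin n) :
    Matrix (Fin n) (Fin n) (MvPolynomial (Fin n) F) :=
  fun i j => (if (j : ℕ) = (i : ℕ) + 1 then 1 else 0) +
    ∑ k : Fin n, if pos k = (i, j) then MvPolynomial.X k else 0

/-- The positions of the variables of `C_{i₁,…,iₙ}`: in 1-based terms `xₖ` lies at
`(iₖ, iₖ−k+1)`; here 0-indexed, given the row function `r`, the variable `x_{k+1}`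
lies at `(r k, r k − k)`. -/
def CPos {n : ℕ} (r : Fin n → Fin n) (k : Fin n) : Fin n × Fin n :=
  (r k, ⟨(r k : ℕ) - (k : ℕ), lt_of_le_of_lt (Nat.sub_le _ _) (r k).isLt⟩)

/-- The condition on the row indices defining the set `𝒞`: in 1-based terms
`k ≤ iₖ` and `iₖ−k+1 ≤ i₁ ≤ iₖ` for `k = 1,…,n`. -/
def IsCIdx {n : ℕ} (hn : 0 < n) (r : Fin n → Fin n) : Prop :=
  ∀ k : Fin n, (k : ℕ) ≤ (r k : ℕ) ∧
    (r k : ℕ) - (k : ℕ) ≤ (r ⟨0, hn⟩ : ℕ) ∧ (r ⟨0, hn⟩ : ℕ) ≤ (r k : ℕ)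

/-- The matrix `C_{i₁,…,iₙ}`. -/
def CMat (F : Type*) [Field F] {n : ℕ} (r : Fin n → Fin n) :
    Matrix (Fin n) (Fin n) (MvPolynomial (Fin n) F) :=
  HMat F (CPos r)

/-- The condition on the row indices defining the set `𝒢`: besides the `𝒞` conditions,
the rows of the variables are exactly `i₁,…,n` and their columns exactly `1,…,i₁`. -/
def IsGIdx {n : ℕ} (hn : 0 < n) (r : Fin n → Fin n) : Prop :=
  IsCIdx hn r ∧
  (∀ i : Fin n, (∃ k, r k = i) ↔ (r ⟨0, hn⟩ : ℕ) ≤ (i : ℕ)) ∧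
  (∀ j : Fin n, (∃ k, (r k : ℕ) - (k : ℕ) = (j : ℕ)) ↔ (j : ℕ) ≤ (r ⟨0, hn⟩ : ℕ))

/-- The condition on the row indices defining the set `ℱ` of Fiedler companion
matrices: besides the `𝒢` conditions, consecutive variables lie in the same row or
the same column, i.e. `i_{k+1} = i_k` or `i_{k+1} = i_k + 1`. -/
def IsFIdx {n : ℕ} (hn : 0 < n) (r : Fin n → Fin n) : Prop :=
  IsGIdx hn r ∧
  ∀ k l : Fin n, (l : ℕ) = (k : ℕ) + 1 → (r l = r k ∨ (r l : ℕ) = (r k : ℕ) + 1)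

/-- `B` is a *ULH superpattern* of `A`: `B` is obtained from `A` by replacing some
(possibly none) zero entries of `A` lying below the superdiagonal by nonzero
constants of `F`. -/
def IsULHSuperpatternOf {F : Type*} [Field F] {n : ℕ}
    (B A : Matrix (Fin n) (Fin n) (MvPolynomial (Fin n) F)) : Prop :=
  (∀ i j : Fin n, (i : ℕ) < (j : ℕ) → B i j = A i j) ∧
  (∀ i j : Fin n, (j : ℕ) ≤ (i : ℕ) →
    B i j = A i j ∨ (A i j = 0 ∧ ∃ c : F, c ≠ 0 ∧ B i j = MvPolynomial.C c))

/-- `A` is a *companion matrix*: `n` of its entries are the variables `x₁,…,xₙ`,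
the remaining entries are constants of `F`, and
`det(λI − A) = λⁿ − x₁λ^{n−1} − ⋯ − xₙ`. -/
def IsCompanion {F : Type*} [Field F] {n : ℕ}
    (A : Matrix (Fin n) (Fin n) (MvPolynomial (Fin n) F)) : Prop :=
  (∃ pos : Fin n → Fin n × Fin n, Function.Injective pos ∧
    (∀ k : Fin n, A (pos k).1 (pos k).2 = MvPolynomial.X k) ∧
    (∀ i j : Fin n, (∀ k, pos k ≠ (i, j)) → ∃ c : F, A i j = MvPolynomial.C c)) ∧
  A.charpoly = Polynomial.X ^ n -
    ∑ k : Fin n, Polynomial.C (MvPolynomial.X k) * Polynomial.X ^ (n - 1 - (k : ℕ))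

/-- `A` is a *PB-companion matrix* (companion with respect to a polynomial basis):
`n` of its entries are the variables `x₁,…,xₙ`, the remaining entries are constants
of `F`, and `det(λI − A) = pₙ(λ) − x₁p_{n−1}(λ) − ⋯ − xₙp₀(λ)` for some basis
`{pₙ,…,p₀}` of the space `F_n[λ]` of polynomials of degree at most `n`. -/
def IsPBCompanion {F : Type*} [Field F] {n : ℕ}
    (A : Matrix (Fin n) (Fin n) (MvPolynomial (Fin n) F)) : Prop :=
  (∃ pos : Fin n → Fin n × Fin n, Function.Injective pos ∧
    (∀ k : Fin n, A (pos k).1 (pos k).2 = MvPolynomial.X k) ∧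
    (∀ i j : Fin n, (∀ k, pos k ≠ (i, j)) → ∃ c : F, A i j = MvPolynomial.C c)) ∧
  ∃ p : Fin (n + 1) → Polynomial F,
    (∀ i, p i ∈ Polynomial.degreeLT F (n + 1)) ∧
    LinearIndependent F p ∧
    Submodule.span F (Set.range p) = Polynomial.degreeLT F (n + 1) ∧
    A.charpoly = (p ⟨n, n.lt_succ_self⟩).map (MvPolynomial.C : F →+* MvPolynomial (Fin n) F) -
      ∑ k : Fin n, Polynomial.C (MvPolynomial.X k) *
        (p ⟨n - 1 - (k : ℕ), by omega⟩).map (MvPolynomial.C : F →+* MvPolynomial (Fin n) F)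

/-- The constant part of `A`: set `x₁ = ⋯ = xₙ = 0` in every entry. -/
def constPart {F : Type*} [Field F] {n : ℕ}
    (A : Matrix (Fin n) (Fin n) (MvPolynomial (Fin n) F)) : Matrix (Fin n) (Fin n) F :=
  A.map (fun q => MvPolynomial.eval (fun _ => (0 : F)) q)

/-- The leading principal submatrix `A[1,…,m]` of order `m`. -/
def leadSub {R : Type*} {n : ℕ} (A : Matrix (Fin n) (Fin n) R) (m : ℕ) (h : m ≤ n) :
    Matrix (Fin m) (Fin m) R :=
  A.submatrix (Fin.castLE h) (Fin.castLE h)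

/-- The trailing principal submatrix `A[n−m+1,…,n]` of order `m`. -/
def trailSub {R : Type*} {n : ℕ} (A : Matrix (Fin n) (Fin n) R) (m : ℕ) (h : m ≤ n) :
    Matrix (Fin m) (Fin m) R :=
  A.submatrix (fun i => ⟨n - m + (i : ℕ), by omega⟩) (fun i => ⟨n - m + (i : ℕ), by omega⟩)

/-- A matrix whose entries are all constants of `F`. -/
def IsConstMatrix {F : Type*} [Field F] {n m : ℕ}
    (M : Matrix (Fin m) (Fin m) (MvPolynomial (Fin n) F)) : Prop :=
  ∀ i j, ∃ c : F, M i j = MvPolynomial.C c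

/-- Membership in `𝔑^m_L(n₁,…,n_s)`: a constant ULH matrix of order `m` whose
leading principal submatrix of order `ns h` is nilpotent whenever `ns h ≠ 0`. -/
def MemNL {F : Type*} [Field F] {m : ℕ} (M : Matrix (Fin m) (Fin m) F)
    {s : ℕ} (ns : Fin s → ℕ) (hns : ∀ h, ns h ≤ m) : Prop :=
  IsULH M ∧ ∀ h : Fin s, ns h ≠ 0 → IsNilpotent (leadSub M (ns h) (hns h))

/-- Membership in `𝔑^m_T(n₁,…,n_s)`: a constant ULH matrix of order `m` whose
trailing principal submatrix of order `ns h` is nilpotent whenever `ns h ≠ 0`. -/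
def MemNT {F : Type*} [Field F] {m : ℕ} (M : Matrix (Fin m) (Fin m) F)
    {s : ℕ} (ns : Fin s → ℕ) (hns : ∀ h, ns h ≤ m) : Prop :=
  IsULH M ∧ ∀ h : Fin s, ns h ≠ 0 → IsNilpotent (trailSub M (ns h) (hns h))

/-- `s_k(A)`: the sum of the entries of the `k`-subdiagonal of `A`. -/
def subdiagSum {F : Type*} [Field F] {n : ℕ}
    (A : Matrix (Fin n) (Fin n) (MvPolynomial (Fin n) F)) (k : ℕ) : MvPolynomial (Fin n) F :=
  ∑ i : Fin n, ∑ j : Fin n, if (i : ℕ) = (j : ℕ) + k then A i j else 0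

/-- The upper shift matrix `Uₘ`: ones on the superdiagonal, zeros elsewhere. -/
def Ushift (R : Type*) [Zero R] [One R] (m : ℕ) : Matrix (Fin m) (Fin m) R :=
  fun i j => if (j : ℕ) = (i : ℕ) + 1 then 1 else 0

/-- The backward identity matrix `Jₘ`: ones on the antidiagonal, zeros elsewhere. -/
def Jmat (R : Type*) [Zero R] [One R] (m : ℕ) : Matrix (Fin m) (Fin m) R :=
  fun i j => if (i : ℕ) + (j : ℕ) = m - 1 then 1 else 0

/-- The principal submatrix `M[b,…,e]` on rows and columns `b,…,e` (0-indexed). -/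
def rangeSub {R : Type*} {m : ℕ} (M : Matrix (Fin m) (Fin m) R) (b e : ℕ) (h : e < m) :
    Matrix (Fin (e + 1 - b)) (Fin (e + 1 - b)) R :=
  M.submatrix (fun i => ⟨b + (i : ℕ), by omega⟩) (fun i => ⟨b + (i : ℕ), by omega⟩)

/-- A matrix with `-1` on the superdiagonal and `0` above it sends some vector with first
coordinate `1` to `d` times the last basis vector only if its determinant is `d`. -/
theorem det_eq_of_mulVec_eq_single_last {R : Type*} [CommRing R] {m : ℕ}
    (M : Matrix (Fin (m + 1)) (Fin (m + 1)) R)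
    (h1 : ∀ i j : Fin (m + 1), (j : ℕ) = (i : ℕ) + 1 → M i j = -1)
    (h0 : ∀ i j : Fin (m + 1), (i : ℕ) + 1 < (j : ℕ) → M i j = 0)
    (v : Fin (m + 1) → R) (hv : v 0 = 1) (d : R)
    (hM : M *ᵥ v = Pi.single (Fin.last m) d) : M.det = d := by
  have h : M.adjugate *ᵥ (M *ᵥ v) = M.det • v := by
    rw [Matrix.mulVec_mulVec, Matrix.adjugate_mul, Matrix.smul_mulVec, Matrix.one_mulVec]
  have hdet : (M.submatrix (Fin.last m).succAbove (0 : Fin (m + 1)).succAbove).det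
      = (-1) ^ m := by
    rw [Matrix.det_of_isLowerTriangular]
    · simp [h1]
    · intro i j hij
      have : (i : ℕ) < (j : ℕ) := hij
      simp only [Matrix.submatrix_apply]
      apply h0
      simpa using this
  have h' := congrFun h 0
  rw [hM] at h'
  simp only [Matrix.mulVec_single, Pi.smul_apply, hv, smul_eq_mul, mul_one] at h'
  rw [← h']
  simp only [Matrix.col_apply, MulOpposite.smul_eq_mul_unop, MulOpposite.unop_op]
  rw [Matrix.adjugate_fin_succ_eq_det_submatrix, hdet]
  simp [← mul_pow]

/-- The characteristic polynomials of the leading principal submatrices of a ULH matrix,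
as a recursively defined sequence; `L` is the part on and below the diagonal. -/
theorem exists_leading_seq {R : Type*} [CommRing R] {n : ℕ} (x : R)
    (L : Matrix (Fin n) (Fin n) R) (hL : ∀ i j, i < j → L i j = 0) :
    ∃ v : ℕ → R, v 0 = 1 ∧ ∀ i : Fin n, v (i + 1) = x * v i - ∑ j, L i j * v j := by
  suffices h : ∀ N, ∃ v : ℕ → R, v 0 = 1 ∧
      ∀ i : Fin n, (i : ℕ) < N → v (i + 1) = x * v i - ∑ j, L i j * v j by
    obtain ⟨v, h0, hv⟩ := h n
    exact ⟨v, h0, fun i => hv i i.isLt⟩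
  intro N
  induction N with
  | zero => exact ⟨fun _ => 1, rfl, fun i hi => absurd hi (Nat.not_lt_zero _)⟩
  | succ N ih =>
    obtain ⟨v, h0, hv⟩ := ih
    by_cases hN : N < n
    · have hsum : ∀ i : Fin n, (i : ℕ) ≤ N → ∀ y,
          ∑ j, L i j * Function.update v (N + 1) y j = ∑ j, L i j * v j := by
        intro i hi y
        refine Finset.sum_congr rfl fun j _ => ?_
        by_cases hj : (j : ℕ) = N + 1
        · rw [hL i j (by rw [Fin.lt_def]; omega), zero_mul, zero_mul]
        · rw [Function.update_of_ne hj]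
      refine ⟨Function.update v (N + 1) (x * v N - ∑ j, L ⟨N, hN⟩ j * v j), ?_, ?_⟩
      · rw [Function.update_of_ne (by omega), h0]
      · intro i hi
        rw [hsum i (by omega), Function.update_of_ne (by omega : (i : ℕ) ≠ N + 1)]
        by_cases hiN : (i : ℕ) = N
        · obtain rfl : i = ⟨N, hN⟩ := Fin.ext hiN
          simp
        · rw [Function.update_of_ne (by omega), hv i (by omega)]
    · exact ⟨v, h0, fun i _ => hv i (by omega)⟩

/-- The characteristic polynomials of the trailing principal submatrices of a ULH matrix,
as a recursively defined sequence; `L` is the part on and below the diagonal. -/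
theorem exists_trailing_seq {R : Type*} [CommRing R] {n : ℕ} (x : R)
    (L : Matrix (Fin n) (Fin n) R) (hL : ∀ i j, i < j → L i j = 0) :
    ∃ w : ℕ → R, w n = 1 ∧
      ∀ j : Fin n, w j = x * w (j + 1) - ∑ i : Fin n, L i j * w (i + 1) := by
  obtain ⟨v, h0, hv⟩ := exists_leading_seq x (fun i j => L j.rev i.rev)
    (fun i j hij => hL _ _ (Fin.rev_lt_rev.mpr hij))
  refine ⟨fun m => v (n - m), by simpa using h0, fun j => ?_⟩
  have h := hv j.rev
  rw [Fin.val_rev, Fin.rev_rev, ← Equiv.sum_comp Fin.revPerm] at h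
  simp only [Fin.revPerm_apply, Fin.rev_rev, Fin.val_rev] at h
  rw [← h]
  exact congrArg v (by have := j.isLt; omega)

/-- Comparison of the leading sequence of `L` with the trailing sequence of `B`. -/
theorem leading_eq_trailing_sub {R : Type*} [CommRing R] {n : ℕ} (x : R)
    (L B : Matrix (Fin n) (Fin n) R) (v w : ℕ → R) (hv0 : v 0 = 1) (hwn : w n = 1)
    (hv : ∀ i : Fin n, v (i + 1) = x * v i - ∑ j, L i j * v j)
    (hw : ∀ j : Fin n, w j = x * w (j + 1) - ∑ i : Fin n, B i j * w (i + 1)) :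
    v n = w 0 - ∑ i, ∑ j, (L i j - B i j) * (w (i + 1) * v j) := by
  have htel := Finset.sum_range_sub (fun m => w m * v m) n
  rw [← Fin.sum_univ_eq_sum_range (fun m => w (m + 1) * v (m + 1) - w m * v m) n] at htel
  have h1 : ∀ i : Fin n, w (i + 1) * v (i + 1)
      = w (i + 1) * (x * v i) - ∑ j, L i j * (w (i + 1) * v j) := by
    intro i
    rw [hv i, mul_sub, Finset.mul_sum]
    congr 1
    exact Finset.sum_congr rfl fun j _ => by ring
  have h2 : ∀ j : Fin n, w j * v j
      = w (j + 1) * (x * v j) - ∑ i : Fin n, B i j * (w (i + 1) * v j) := by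
    intro j
    rw [hw j, sub_mul, Finset.sum_mul]
    congr 1
    · ring
    · exact Finset.sum_congr rfl fun i _ => by ring
  simp only [Finset.sum_sub_distrib] at htel
  rw [Finset.sum_congr rfl fun i _ => h1 i, Finset.sum_congr rfl fun j _ => h2 j] at htel
  simp only [Finset.sum_sub_distrib] at htel
  rw [Finset.sum_comm (f := fun j i : Fin n => B i j * (w (i + 1) * v j))] at htel
  simp only [sub_mul, Finset.sum_sub_distrib]
  rw [hwn, hv0] at htel
  linear_combination -htel

/-- The characteristic polynomial of a ULH matrix is the last term of its leading sequence. -/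
theorem charpoly_ushift_add_eq {R : Type*} [CommRing R] {n : ℕ}
    (L : Matrix (Fin n) (Fin n) R) (hL : ∀ i j, i < j → L i j = 0)
    (v : ℕ → R[X]) (hv0 : v 0 = 1)
    (hv : ∀ i : Fin n, v (i + 1) = X * v i - ∑ j, C (L i j) * v j) :
    (Ushift R n + L).charpoly = v n := by
  cases n with
  | zero => simp [hv0]
  | succ m =>
    refine det_eq_of_mulVec_eq_single_last _ ?_ ?_ (fun j => v j) (by simpa using hv0) _ ?_
    · intro i j hij
      rw [charmatrix_apply_ne _ _ _ (fun h => by rw [h] at hij; omega)]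
      simp [Ushift, hij, hL i j (by rw [Fin.lt_def]; omega)]
    · intro i j hij
      rw [charmatrix_apply_ne _ _ _ (fun h => by rw [h] at hij; omega)]
      simp [Ushift, hij.ne', hL i j (by rw [Fin.lt_def]; omega)]
    · funext i
      have hU : ∑ j : Fin (m + 1), C (Ushift R (m + 1) i j) * v j
          = if i = Fin.last m then 0 else v (i + 1) := by
        split_ifs with hi
        · refine Finset.sum_eq_zero fun j _ => ?_
          have : (j : ℕ) ≠ (i : ℕ) + 1 := by
            rw [hi, Fin.val_last]; omega
          simp [Ushift, this]
        · have hi' : (i : ℕ) + 1 < m + 1 := by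
            have := Fin.val_lt_last hi
            omega
          rw [Finset.sum_eq_single ⟨(i : ℕ) + 1, hi'⟩]
          · simp [Ushift]
          · intro j _ hj
            have : (j : ℕ) ≠ (i : ℕ) + 1 := fun h => hj (Fin.ext h)
            simp [Ushift, this]
          · simp
      have hrow : (charmatrix (Ushift R (m + 1) + L) *ᵥ fun j : Fin (m + 1) => v j) i
          = X * v i - ∑ j, C (L i j) * v j
            - ∑ j : Fin (m + 1), C (Ushift R (m + 1) i j) * v j := by
        simp only [Matrix.mulVec, dotProduct, charmatrix_apply, Matrix.add_apply, C_add,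
          sub_mul, add_mul, Finset.sum_sub_distrib, Finset.sum_add_distrib]
        simp only [Matrix.diagonal_apply, ite_mul, zero_mul, Finset.sum_ite_eq,
          Finset.mem_univ, if_true]
        ring
      rw [hrow, ← hv, hU]
      by_cases hi : i = Fin.last m
      · subst hi; simp
      · simp [hi]

/-- A leading sequence of `L` that starts at `1` consists of powers of `X` as long as the
rows of `L` vanish. -/
theorem leading_eq_X_pow {R : Type*} [CommRing R] {n : ℕ} (t : Fin n)
    (L : Matrix (Fin n) (Fin n) R) (hL : ∀ i j, i < t → L i j = 0)
    (v : ℕ → R[X]) (hv0 : v 0 = 1)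
    (hv : ∀ i : Fin n, v (i + 1) = X * v i - ∑ j, C (L i j) * v j) :
    ∀ m : ℕ, m ≤ t → v m = X ^ m := by
  intro m
  induction m with
  | zero => intro _; simpa using hv0
  | succ m ih =>
    intro hm
    have h := hv ⟨m, by omega⟩
    rw [Finset.sum_eq_zero fun j _ => by rw [hL _ j (by rw [Fin.lt_def]; exact hm)]; simp,
      ih (by omega)] at h
    rw [h, pow_succ']
    ring

/-- Leading sequences are compatible with ring homomorphisms, as long as the rows agree. -/
theorem leading_eq_map {R S : Type*} [CommRing R] [CommRing S] (f : R →+* S) {n : ℕ}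
    (t : Fin n) (L : Matrix (Fin n) (Fin n) S) (hL : ∀ i j, i < j → L i j = 0)
    (c : Matrix (Fin n) (Fin n) R) (hc : ∀ i j, i < j → c i j = 0)
    (hLc : ∀ i j, i < t → L i j = f (c i j))
    (v : ℕ → S[X]) (hv0 : v 0 = 1)
    (hv : ∀ i : Fin n, v (i + 1) = X * v i - ∑ j, C (L i j) * v j)
    (p : ℕ → R[X]) (hp0 : p 0 = 1)
    (hp : ∀ i : Fin n, p (i + 1) = X * p i - ∑ j, C (c i j) * p j) :
    ∀ m : ℕ, m ≤ t → v m = (p m).map f := by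
  intro m
  induction m using Nat.strong_induction_on with
  | _ m ih =>
    cases m with
    | zero => intro _; simp [hp0, hv0]
    | succ m =>
      intro hm
      have hmn : m < n := by omega
      have e1 := hv ⟨m, hmn⟩
      have e2 := hp ⟨m, hmn⟩
      rw [e1, e2, ih m (by omega) (by omega)]
      simp only [Polynomial.map_sub, Polynomial.map_mul, Polynomial.map_X,
        Polynomial.map_sum, Polynomial.map_C]
      congr 1
      refine Finset.sum_congr rfl fun j _ => ?_
      rcases lt_or_ge m (j : ℕ) with hj | hj
      · rw [hL _ _ (by rw [Fin.lt_def]; exact hj), hc _ _ (by rw [Fin.lt_def]; exact hj)]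
        simp
      · rw [ih j (by omega) (by omega), hLc ⟨m, hmn⟩ j (by rw [Fin.lt_def]; exact hm)]

/-- The characteristic polynomial of a ULH matrix whose entries on and below the diagonal
all lie in the block of rows `≥ t` and columns `≤ t`. -/
theorem charpoly_eq_of_block {F : Type*} [Field F] {n : ℕ} (t : Fin n)
    (L : Matrix (Fin n) (Fin n) (MvPolynomial (Fin n) F))
    (hL : ∀ i j, L i j ≠ 0 → t ≤ i ∧ j ≤ t) :
    (Ushift _ n + L).charpoly = X ^ n -
      ∑ k : Fin n, C (subdiagSum (Ushift _ n + L) (k : ℕ)) * X ^ (n - 1 - (k : ℕ)) := by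
  have hlow : ∀ i j, i < j → L i j = 0 := by
    intro i j hij
    by_contra h
    have := hL i j h
    exact absurd (this.2.trans this.1) (not_le.mpr hij)
  obtain ⟨v, hv0, hv⟩ := exists_leading_seq (X : (MvPolynomial (Fin n) F)[X])
    (fun i j => C (L i j)) (fun i j hij => by simp [hlow i j hij])
  rw [charpoly_ushift_add_eq L hlow v hv0 hv,
    leading_eq_trailing_sub X (fun i j => C (L i j)) 0 v (fun m => X ^ (n - m)) hv0
      (by simp) hv]
  · simp only [tsub_zero]
    congr 1
    simp only [subdiagSum, map_sum, Finset.sum_mul]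
    rw [Finset.sum_comm]
    refine Eq.trans ?_ Finset.sum_comm.symm
    rw [Finset.sum_comm]
    refine Finset.sum_congr rfl fun i _ => ?_
    rw [Finset.sum_comm]
    refine Finset.sum_congr rfl fun j _ => ?_
    simp only [Matrix.zero_apply, sub_zero]
    by_cases hz : L i j = 0
    · rw [hz, C_0, zero_mul, Finset.sum_eq_zero]
      intro k _
      split_ifs with hk
      · have : (j : ℕ) ≠ (i : ℕ) + 1 := by omega
        simp [Ushift, hz, this]
      · simp
    · obtain ⟨h1, h2⟩ := hL i j hz
      have hji : (j : ℕ) ≤ (i : ℕ) := h2.trans h1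
      rw [Finset.sum_eq_single ⟨(i : ℕ) - (j : ℕ), by omega⟩]
      · have : (j : ℕ) ≠ (i : ℕ) + 1 := by omega
        rw [leading_eq_X_pow t L (fun i j hi => by
          by_contra h; exact absurd (hL i j h).1 (not_le.mpr hi)) v hv0 hv j h2, ← pow_add]
        simp only [Matrix.add_apply, Ushift, this, if_false, zero_add]
        rw [if_pos (by omega)]
        congr 2
        omega
      · intro k _ hk
        rw [if_neg, C_0, zero_mul]
        intro h
        exact hk (Fin.ext (by simp; omega))
      · simp
  · intro j
    simp only [Matrix.zero_apply, zero_mul, Finset.sum_const_zero, sub_zero]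
    rw [← pow_succ']
    congr 1
    omega

/-- The variable part of the matrix `C_{i₁,…,iₙ}`. -/
def varPart (F : Type*) [Field F] {n : ℕ} (r : Fin n → Fin n) :
    Matrix (Fin n) (Fin n) (MvPolynomial (Fin n) F) :=
  fun i j => ∑ k : Fin n, if CPos r k = (i, j) then MvPolynomial.X k else 0

theorem CMat_eq (F : Type*) [Field F] {n : ℕ} (r : Fin n → Fin n) :
    CMat F r = Ushift _ n + varPart F r := rfl

theorem varPart_block {F : Type*} [Field F] {n : ℕ} (hn : 0 < n) {r : Fin n → Fin n}
    (hr : IsCIdx hn r) (i j : Fin n) (h : varPart F r i j ≠ 0) :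
    r ⟨0, hn⟩ ≤ i ∧ j ≤ r ⟨0, hn⟩ := by
  obtain ⟨k, -, hk⟩ := Finset.exists_ne_zero_of_sum_ne_zero h
  have hk' : CPos r k = (i, j) := by
    by_contra hne
    exact hk (if_neg hne)
  obtain ⟨-, h2, h3⟩ := hr k
  rw [CPos, Prod.mk.injEq] at hk'
  obtain ⟨rfl, rfl⟩ := hk'
  exact ⟨h3, h2⟩

theorem CPos_injective {n : ℕ} (hn : 0 < n) {r : Fin n → Fin n} (hr : IsCIdx hn r) :
    Function.Injective (CPos r) := by
  intro k l h
  have h1 := congrArg (fun a => (a.1 : ℕ)) h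
  have h2 := congrArg (fun a => (a.2 : ℕ)) h
  simp only [CPos] at h1 h2
  have hk := (hr k).1
  have hl := (hr l).1
  exact Fin.ext (by omega)

theorem varPart_CPos {F : Type*} [Field F] {n : ℕ} (hn : 0 < n) {r : Fin n → Fin n}
    (hr : IsCIdx hn r) (k : Fin n) :
    varPart F r (CPos r k).1 (CPos r k).2 = MvPolynomial.X k := by
  rw [varPart, Finset.sum_eq_single k]
  · simp
  · intro l _ hl
    exact if_neg fun h => hl (CPos_injective hn hr h)
  · simp

theorem CMat_CPos {F : Type*} [Field F] {n : ℕ} (hn : 0 < n) {r : Fin n → Fin n}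
    (hr : IsCIdx hn r) (k : Fin n) :
    CMat F r (CPos r k).1 (CPos r k).2 = MvPolynomial.X k := by
  rw [CMat_eq, Matrix.add_apply, varPart_CPos hn hr, Ushift, if_neg, zero_add]
  simp only [CPos]
  omega

/-- A ULH superpattern of `M` differs from `M` by a lower triangular constant matrix. -/
theorem IsULHSuperpatternOf.exists_const {F : Type*} [Field F] {n : ℕ}
    {A M : Matrix (Fin n) (Fin n) (MvPolynomial (Fin n) F)} (hA : IsULHSuperpatternOf A M) :
    ∃ c : Matrix (Fin n) (Fin n) F, (∀ i j, i < j → c i j = 0) ∧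
      A = M + c.map MvPolynomial.C := by
  have h : ∀ i j, ∃ c : F, (i < j → c = 0) ∧ A i j = M i j + MvPolynomial.C c := by
    intro i j
    rcases lt_or_ge i j with hij | hij
    · exact ⟨0, fun _ => rfl, by simpa using hA.1 i j hij⟩
    · rcases hA.2 i j hij with h | ⟨h, c, -, hc⟩
      · exact ⟨0, fun _ => rfl, by simpa using h⟩
      · exact ⟨c, fun h' => absurd h' (not_lt.mpr hij), by rw [hc, h, zero_add]⟩
  choose c hc0 hc using h
  exact ⟨c, hc0, by ext1 i j; exact hc i j⟩

/-- The coefficients of the variables in an affine combination are determined. -/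
theorem eq_of_affine_eq {F σ : Type*} [Field F] [Fintype σ] (p q : F[X]) (f g : σ → F[X])
    (h : p.map (MvPolynomial.C : F →+* MvPolynomial σ F) -
        ∑ k, C (MvPolynomial.X k) * (f k).map MvPolynomial.C =
      q.map (MvPolynomial.C : F →+* MvPolynomial σ F) -
        ∑ k, C (MvPolynomial.X k) * (g k).map MvPolynomial.C) : f = g := by
  classical
  funext k
  ext e
  have h' := congrArg (fun P => MvPolynomial.coeff (Finsupp.single k 1) (Polynomial.coeff P e)) h
  simpa [Polynomial.finsetSum_coeff, MvPolynomial.coeff_sum, MvPolynomial.coeff_C,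
    mul_comm (MvPolynomial.X _), MvPolynomial.coeff_C_mul, MvPolynomial.coeff_X, Finsupp.single_left_inj,
    Finsupp.single_eq_zero, eq_comm (a := (0 : σ →₀ ℕ))] using h'

/-- If `∑ C (a j) * X ^ e j = 0` with distinct exponents, then all `a j` vanish. -/
theorem eq_zero_of_sum_C_mul_X_pow {R ι : Type*} [CommRing R] [Fintype ι] (a : ι → R)
    (e : ι → ℕ) (he : Function.Injective e) (h : ∑ j, C (a j) * X ^ e j = (0 : R[X])) (j : ι) :
    a j = 0 := by
  classical
  have h' := congrArg (fun P => Polynomial.coeff P (e j)) h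
  simpa [Polynomial.finsetSum_coeff, coeff_C_mul, coeff_X_pow, he.eq_iff] using h'

/-- If a superpattern of a Fiedler companion matrix has the right characteristic polynomial,
then its constants on and below the diagonal lie in the `i₁`-block. -/
theorem const_block_of_charpoly {F : Type*} [Field F] {n : ℕ} (hn : 0 < n)
    {r : Fin n → Fin n} (hr : IsFIdx hn r) (c : Matrix (Fin n) (Fin n) F)
    (hc : ∀ i j, i < j → c i j = 0)
    (h : (CMat F r + c.map MvPolynomial.C).charpoly = Polynomial.X ^ n -
      ∑ k : Fin n, Polynomial.C (MvPolynomial.X k) * Polynomial.X ^ (n - 1 - (k : ℕ)))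
    (i j : Fin n) (hij : c i j ≠ 0) : r ⟨0, hn⟩ ≤ i ∧ j ≤ r ⟨0, hn⟩ := by
  obtain ⟨⟨hC, hrow, hcol⟩, hstep⟩ := hr
  set t := r ⟨0, hn⟩
  have hV : ∀ i j, i < j → varPart F r i j = 0 := by
    intro i j hij
    by_contra hne
    have := varPart_block hn hC i j hne
    exact absurd (this.2.trans this.1) (not_le.mpr hij)
  have hVt : ∀ i j, i < t → varPart F r i j = 0 := by
    intro i j hij
    by_contra hne
    exact absurd (varPart_block hn hC i j hne).1 (not_le.mpr hij)
  set L := varPart F r + c.map MvPolynomial.C with hLdef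
  have hL : ∀ i j, i < j → L i j = 0 := by
    intro i j hij
    simp [hLdef, hV i j hij, hc i j hij]
  obtain ⟨p, hp0, hp⟩ := exists_leading_seq (X : F[X]) (fun i j => C (c i j))
    (fun i j hij => by simp [hc i j hij])
  obtain ⟨w, hwn, hw⟩ := exists_trailing_seq (X : F[X]) (fun i j => C (c i j))
    (fun i j hij => by simp [hc i j hij])
  obtain ⟨v, hv0, hv⟩ := exists_leading_seq (X : (MvPolynomial (Fin n) F)[X])
    (fun i j => C (L i j)) (fun i j hij => by simp [hL i j hij])
  have hvp : ∀ m : ℕ, m ≤ t → v m = (p m).map MvPolynomial.C :=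
    leading_eq_map MvPolynomial.C t L hL c hc
      (fun i j hi => by simp [hLdef, hVt i j hi]) v hv0 hv p hp0 hp
  have hchar := charpoly_ushift_add_eq L hL v hv0 hv
  rw [leading_eq_trailing_sub X (fun i j => C (L i j))
    (fun i j => C (MvPolynomial.C (c i j))) v (fun m => (w m).map MvPolynomial.C)
    hv0 (by simp [hwn]) hv (fun j => by
      rw [hw j]
      simp [Polynomial.map_sum])] at hchar
  have hsum : ∑ i : Fin n, ∑ j : Fin n, (C (L i j) - C (MvPolynomial.C (c i j))) *
      ((w (i + 1)).map MvPolynomial.C * v j) = ∑ k : Fin n, C (MvPolynomial.X k) *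
        (w (r k + 1) * p (r k - k)).map MvPolynomial.C := by
    have : ∀ i j : Fin n, (C (L i j) - C (MvPolynomial.C (c i j))) *
        ((w (i + 1)).map MvPolynomial.C * v j) = ∑ k : Fin n, if CPos r k = (i, j) then
          C (MvPolynomial.X k) * (w (r k + 1) * p (r k - k)).map MvPolynomial.C else 0 := by
      intro i j
      simp only [hLdef, Matrix.add_apply, Matrix.map_apply, C_add, add_sub_cancel_right, varPart,
        map_sum, Finset.sum_mul]
      refine Finset.sum_congr rfl fun k _ => ?_
      split_ifs with hk
      · rw [CPos, Prod.mk.injEq] at hk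
        obtain ⟨rfl, rfl⟩ := hk
        rw [hvp _ (hC k).2.1, Polynomial.map_mul]
      · simp
    simp only [this]
    rw [← Fintype.sum_prod_type', Finset.sum_comm]
    refine Finset.sum_congr rfl fun k _ => ?_
    simp
  rw [CMat_eq, add_assoc, hchar, hsum] at h
  have hX : ∀ k : Fin n, w (r k + 1) * p (r k - k) = X ^ (n - 1 - (k : ℕ)) := by
    refine congrFun (f := fun k : Fin n => w (r k + 1) * p (r k - k)) (eq_of_affine_eq (w 0) (X ^ n) _
      (fun k : Fin n => (X : F[X]) ^ (n - 1 - (k : ℕ))) ?_)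
    simpa only [Polynomial.map_pow, Polynomial.map_X] using h
  have hpow := fun (a b : ℕ) (y : F[X]) (hy : X ^ a * y = X ^ (a + b)) =>
    mul_left_cancel₀ (pow_ne_zero a (X_ne_zero (R := F))) (hy.trans (pow_add X a b))
  have hpath : ∀ m : ℕ, ∀ k : Fin n, (k : ℕ) + m = n - 1 →
      w (r k + 1) = X ^ (n - 1 - (r k : ℕ)) ∧ p (r k - k) = X ^ ((r k : ℕ) - (k : ℕ)) := by
    intro m
    induction m with
    | zero =>
      intro k hk
      have h1 := (hC k).1
      have h2 : (r k : ℕ) = n - 1 := by omega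
      have h3 : (r k : ℕ) - k = 0 := by omega
      rw [h3, hp0, h2, Nat.sub_add_cancel hn, hwn]
      simp
    | succ m ih =>
      intro k hk
      have hkn : (k : ℕ) + 1 < n := by omega
      have hk1 := (hC k).1
      have hXk := hX k
      have hl := ih ⟨k + 1, hkn⟩ (by simp only; omega)
      rcases hstep k ⟨k + 1, hkn⟩ rfl with hs | hs
      · rw [hs] at hl
        refine ⟨hl.1, hpow (n - 1 - r k) _ _ ?_⟩
        rw [← hl.1, hXk]
        congr 1
        omega
      · rw [hs] at hl
        have : (r k : ℕ) + 1 - (k + 1) = r k - k := by omega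
        simp only [this] at hl
        refine ⟨hpow (r k - k) _ _ ?_, hl.2⟩
        rw [← hl.2, mul_comm, hXk]
        congr 1
        omega
  have hp_pow : ∀ j : Fin n, j ≤ t → p j = X ^ (j : ℕ) := by
    intro j hj
    obtain ⟨k, hk⟩ := (hcol j).mpr hj
    rw [← hk]
    exact (hpath (n - 1 - k) k (by omega)).2
  have hw_pow : ∀ i : Fin n, t ≤ i → w (i + 1) = X ^ (n - 1 - (i : ℕ)) := by
    intro i hi
    obtain ⟨k, rfl⟩ := (hrow i).mpr hi
    exact (hpath (n - 1 - k) k (by omega)).1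
  constructor
  · by_contra! hi
    have e := hp i
    have hi1 : (i : ℕ) + 1 < n := by have := t.isLt; rw [Fin.lt_def] at hi; omega
    have e1 := hp_pow ⟨i + 1, hi1⟩ hi
    simp only at e1
    rw [e1, hp_pow i hi.le, ← pow_succ', eq_comm, sub_eq_self] at e
    refine hij (eq_zero_of_sum_C_mul_X_pow (c i) (fun j : Fin n => (j : ℕ)) Fin.val_injective ?_ j)
    rw [← e]
    refine Finset.sum_congr rfl fun l _ => ?_
    rcases lt_or_ge i l with hl | hl
    · simp [hc i l hl]
    · rw [hp_pow l (hl.trans hi.le)]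
  · by_contra! hj
    have e := hw j
    have hj1 : (j : ℕ) - 1 + 1 = j := by rw [Fin.lt_def] at hj; omega
    have e1 := hw_pow ⟨j - 1, by omega⟩ (by rw [Fin.le_def]; rw [Fin.lt_def] at hj; simp only; omega)
    simp only [hj1] at e1
    rw [e1, hw_pow j hj.le, ← pow_succ', show n - 1 - ((j : ℕ) - 1) = n - 1 - j + 1 by omega,
      eq_comm, sub_eq_self] at e
    refine hij (eq_zero_of_sum_C_mul_X_pow (fun i => c i j) (fun i : Fin n => n - 1 - (i : ℕ))
      (fun a b hab => ?_) ?_ i)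
    · exact Fin.ext (by simp only at hab; omega)
    · rw [← e]
      refine Finset.sum_congr rfl fun l _ => ?_
      rcases lt_or_ge l j with hl | hl
      · simp [hc l j hl]
      · rw [hw_pow l (hj.le.trans hl)]

/-- Let `A` be obtained from a Fiedler companion matrix
`F_{i₁,…,iₙ}` by changing some zero entries lying below the superdiagonal to nonzero
constants. Then `A` is a companion matrix iff all the changed entries lie in the
`i₁`-block and `s_{k−1}(A) = xₖ` for every `k = 1,…,n`. -/
theorem fiedler_superpattern_isCompanion_iff {F : Type*} [Field F] {n : ℕ} (hn : 0 < n)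
    (r : Fin n → Fin n) (hr : IsFIdx hn r)
    (A : Matrix (Fin n) (Fin n) (MvPolynomial (Fin n) F))
    (hA : IsULHSuperpatternOf A (CMat F r)) :
    IsCompanion A ↔
      ((∀ i j : Fin n, (j : ℕ) ≤ (i : ℕ) → A i j ≠ CMat F r i j →
        ((r ⟨0, hn⟩ : ℕ) ≤ (i : ℕ) ∧ (j : ℕ) ≤ (r ⟨0, hn⟩ : ℕ))) ∧
      ∀ k : Fin n, subdiagSum A (k : ℕ) = MvPolynomial.X k) := by
  obtain ⟨c, hc0, rfl⟩ := hA.exists_const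
  have hC : IsCIdx hn r := hr.1.1
  have hchange : ∀ i j : Fin n,
      (CMat F r + c.map (MvPolynomial.C : F →+* MvPolynomial (Fin n) F)) i j ≠ CMat F r i j ↔
        c i j ≠ 0 := by
    intro i j
    simp
  have hblock : (∀ i j, c i j ≠ 0 → r ⟨0, hn⟩ ≤ i ∧ j ≤ r ⟨0, hn⟩) →
      (CMat F r + c.map MvPolynomial.C).charpoly = X ^ n - ∑ k : Fin n,
        C (subdiagSum (CMat F r + c.map MvPolynomial.C) (k : ℕ)) * X ^ (n - 1 - (k : ℕ)) := by
    intro h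
    rw [CMat_eq, add_assoc]
    refine charpoly_eq_of_block (r ⟨0, hn⟩) _ fun i j hij => ?_
    by_cases hcij : c i j = 0
    · refine varPart_block (F := F) hn hC i j fun hv => hij ?_
      simp [hv, hcij]
    · exact h i j hcij
  constructor
  · rintro ⟨-, hchar⟩
    have hb := const_block_of_charpoly hn hr c hc0 hchar
    refine ⟨fun i j _ hij => hb i j ((hchange i j).mp hij), fun k => ?_⟩
    have h := (hblock hb).symm.trans hchar
    rw [sub_right_inj, ← sub_eq_zero, ← Finset.sum_sub_distrib] at h
    simp only [← sub_mul, ← C_sub] at h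
    refine sub_eq_zero.mp (eq_zero_of_sum_C_mul_X_pow _ _ (fun a b hab => ?_) h k)
    exact Fin.ext (by omega)
  · rintro ⟨hb, hs⟩
    have hb' : ∀ i j, c i j ≠ 0 → r ⟨0, hn⟩ ≤ i ∧ j ≤ r ⟨0, hn⟩ := fun i j hij =>
      hb i j (not_lt.mp fun h => hij (hc0 i j h)) ((hchange i j).mpr hij)
    refine ⟨⟨CPos r, CPos_injective hn hC, fun k => ?_, fun i j hij => ?_⟩, ?_⟩
    · rcases hA.2 (CPos r k).1 (CPos r k).2 (Nat.sub_le _ _) with h | ⟨h, -⟩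
      · rw [h, CMat_CPos hn hC]
      · rw [CMat_CPos hn hC] at h
        exact absurd h (MvPolynomial.X_ne_zero k)
    · refine ⟨(if (j : ℕ) = (i : ℕ) + 1 then 1 else 0) + c i j, ?_⟩
      have : varPart F r i j = 0 := Finset.sum_eq_zero fun k _ => if_neg (hij k)
      rw [CMat_eq, Matrix.add_apply, Matrix.add_apply, this, Ushift]
      split_ifs <;> simp
    · rw [hblock hb']
      simp only [hs]
end
end

section
/- Let A be a ULH superpattern of B_{(i_1,j_1),…,(i_n,j_n)} ∈ ℬ. If A is PB-companion, then for every k = 1,…,n the variable x_k lies strictly above the k-subdiagonal of A, i.e., i_k − j_k < k. -/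
open Polynomial Matrix

noncomputable section

/-- Replacing row `i` of the characteristic matrix of a lower Hessenberg matrix by the `j`-th
unit vector, `j ≤ i`, gives a determinant of degree at most `n - 1 - (i - j)`. -/
theorem natDegree_det_updateRow_charmatrix_le {R : Type*} [CommRing R] {n : ℕ}
    (M : Matrix (Fin n) (Fin n) R) (hM : ∀ i j : Fin n, (i : ℕ) + 1 < (j : ℕ) → M i j = 0)
    (i j : Fin n) (hij : (j : ℕ) ≤ i) :
    ((charmatrix M).updateRow i (Pi.single j 1)).det.natDegree ≤ n - 1 - ((i : ℕ) - j) := by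
  rw [← det_transpose, det_apply]
  refine natDegree_sum_le_of_forall_le _ _ fun σ _ => (natDegree_smul_le _ _).trans ?_
  simp only [transpose_apply]
  set N := (charmatrix M).updateRow i (Pi.single j 1) with hN
  by_cases h0 : ∏ r, N r (σ r) = 0
  · simp [h0]
  have hne : ∀ r, N r (σ r) ≠ 0 := fun r hr => h0 (Finset.prod_eq_zero (Finset.mem_univ r) hr)
  have hσi : σ i = j := by
    by_contra h
    exact hne i (by simp [hN, h])
  have hσ : ∀ r, (σ r : ℕ) ≤ r + 1 := by
    intro r
    by_cases hr : r = i
    · subst hr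
      rw [hσi]
      omega
    by_contra! h
    have hrσ : r ≠ σ r := fun e => by rw [← e] at h; omega
    exact hne r (by simp [hN, updateRow_ne hr, charmatrix_apply_ne _ _ _ hrσ, hM _ _ h])
  have hdeg : ∀ r, (N r (σ r)).natDegree ≤ if r = i then 0 else 1 + (r : ℕ) - σ r := by
    intro r
    split_ifs with hr
    · subst hr
      simp [hN, hσi]
    · rw [hN, updateRow_ne hr]
      refine charmatrix_apply_natDegree_le r (σ r) |>.trans ?_
      split_ifs with h
      · rw [← h]
        omega
      · exact Nat.zero_le _
  refine (natDegree_prod_le _ _).trans ((Finset.sum_le_sum fun r _ => hdeg r).trans ?_)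
  have hterm : ∀ r : Fin n, (if r = i then 0 else 1 + (r : ℕ) - σ r) + (σ r : ℕ) +
      (if r = i then 1 + (i : ℕ) - j else 0) = 1 + r := by
    intro r
    have := hσ r
    split_ifs with hr
    · subst hr
      rw [hσi]
      omega
    · omega
  have hsum := Finset.sum_congr (rfl : (Finset.univ : Finset (Fin n)) = _) fun r _ => hterm r
  rw [Finset.sum_add_distrib, Finset.sum_add_distrib, Finset.sum_add_distrib,
    Equiv.sum_comp σ fun r => (r : ℕ), Finset.sum_ite_eq' Finset.univ i] at hsum
  simp only [Finset.mem_univ, if_true, Finset.sum_const, Finset.card_univ, Fintype.card_fin,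
    smul_eq_mul, mul_one] at hsum
  omega

/-- Adding `1` to the entry `(i, j)` with `j ≤ i` of a lower Hessenberg matrix changes its
characteristic polynomial by a polynomial of degree at most `n - 1 - (i - j)`. -/
theorem natDegree_charpoly_sub_charpoly_updateRow_le {R : Type*} [CommRing R] {n : ℕ}
    (M : Matrix (Fin n) (Fin n) R) (hM : ∀ i j : Fin n, (i : ℕ) + 1 < (j : ℕ) → M i j = 0)
    (i j : Fin n) (hij : (j : ℕ) ≤ i) :
    (M.charpoly - (M.updateRow i (M i + Pi.single j 1)).charpoly).natDegree ≤
      n - 1 - ((i : ℕ) - j) := by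
  have hchar : charmatrix (M.updateRow i (M i + Pi.single j 1)) =
      (charmatrix M).updateRow i (charmatrix M i + (-1 : R[X]) • Pi.single j 1) := by
    ext1 a b
    by_cases ha : a = i
    · subst ha
      by_cases hb : b = j
      · subst hb
        simp [charmatrix_apply]
        ring
      · simp [charmatrix_apply, hb]
    · simp [charmatrix_apply, ha]
  have hdet : M.charpoly - (M.updateRow i (M i + Pi.single j 1)).charpoly =
      ((charmatrix M).updateRow i (Pi.single j 1)).det := by
    rw [Matrix.charpoly, Matrix.charpoly, hchar, det_updateRow_add, det_updateRow_smul,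
      updateRow_eq_self]
    ring
  rw [hdet]
  exact natDegree_det_updateRow_charmatrix_le M hM i j hij

theorem finrank_degreeLT (F : Type*) [Field F] (m : ℕ) :
    Module.finrank F (degreeLT F m) = m := by
  rw [(degreeLTEquiv F m).finrank_eq, Module.finrank_fin_fun]

theorem IsHPos.injective {n : ℕ} {pos : Fin n → Fin n × Fin n} (hpos : IsHPos pos) :
    Function.Injective pos := by
  have hlt : ∀ k l, k < l → pos k ≠ pos l := by
    intro k l h e
    have := hpos.2 k l h
    rw [e, Prec] at this
    omega
  intro k l e
  rcases lt_trichotomy k l with h | h | h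
  · exact absurd e (hlt k l h)
  · exact h
  · exact absurd e.symm (hlt l k h)

theorem IsHPos.sub_mono {n : ℕ} {pos : Fin n → Fin n × Fin n} (hpos : IsHPos pos)
    {k l : Fin n} (hkl : k ≤ l) :
    ((pos k).1 : ℕ) - ((pos k).2 : ℕ) ≤ ((pos l).1 : ℕ) - ((pos l).2 : ℕ) := by
  rcases hkl.eq_or_lt with rfl | h
  · exact le_rfl
  · have := hpos.2 k l h
    rw [Prec] at this
    omega

theorem HMat_apply_pos (F : Type*) [Field F] {n : ℕ} {pos : Fin n → Fin n × Fin n}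
    (hpos : IsHPos pos) (k : Fin n) :
    HMat F pos (pos k).1 (pos k).2 = MvPolynomial.X k := by
  have h := hpos.1 k
  simp only [HMat, Prod.mk.eta, hpos.injective.eq_iff, Finset.sum_ite_eq', Finset.mem_univ, if_true]
  rw [if_neg (by omega), zero_add]

theorem HMat_apply_of_forall_ne (F : Type*) [Field F] {n : ℕ} {pos : Fin n → Fin n × Fin n}
    {i j : Fin n} (h : ∀ k, pos k ≠ (i, j)) :
    HMat F pos i j = if (j : ℕ) = (i : ℕ) + 1 then 1 else 0 := by
  simp [HMat, h]

namespace IsULHSuperpatternOf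

variable {F : Type*} [Field F] {n : ℕ} {pos : Fin n → Fin n × Fin n}
  {A : Matrix (Fin n) (Fin n) (MvPolynomial (Fin n) F)}

theorem apply_pos (hpos : IsHPos pos) (hA : IsULHSuperpatternOf A (HMat F pos)) (k : Fin n) :
    A (pos k).1 (pos k).2 = MvPolynomial.X k := by
  have h := HMat_apply_pos F hpos k
  rcases hA.2 _ _ (hpos.1 k) with h' | ⟨h', -⟩
  · rw [h', h]
  · exact absurd (h.symm.trans h') (MvPolynomial.X_ne_zero k)

theorem exists_eq_C (hA : IsULHSuperpatternOf A (HMat F pos)) {i j : Fin n}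
    (h : ∀ k, pos k ≠ (i, j)) : ∃ c : F, A i j = MvPolynomial.C c := by
  have hH : ∃ c : F, HMat F pos i j = MvPolynomial.C c := by
    rw [HMat_apply_of_forall_ne F h]
    split_ifs
    · exact ⟨1, MvPolynomial.C_1.symm⟩
    · exact ⟨0, MvPolynomial.C_0.symm⟩
  rcases lt_or_ge (i : ℕ) j with hij | hij
  · rwa [hA.1 i j hij]
  · rcases hA.2 i j hij with h' | ⟨-, c, -, hc⟩
    · rwa [h']
    · exact ⟨c, hc⟩

theorem apply_eq_zero (hpos : IsHPos pos) (hA : IsULHSuperpatternOf A (HMat F pos))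
    {i j : Fin n} (hij : (i : ℕ) + 1 < j) : A i j = 0 := by
  rw [hA.1 i j (by omega), HMat_apply_of_forall_ne F, if_neg (by omega)]
  intro k hk
  have := hpos.1 k
  rw [hk] at this
  simp only at this
  omega

theorem map_eval_single (hpos : IsHPos pos) (hA : IsULHSuperpatternOf A (HMat F pos))
    (k : Fin n) :
    A.map (MvPolynomial.eval (Pi.single k (1 : F))) =
      (A.map (MvPolynomial.eval (0 : Fin n → F))).updateRow (pos k).1
        (A.map (MvPolynomial.eval (0 : Fin n → F)) (pos k).1 + Pi.single (pos k).2 1) := by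
  ext a b
  by_cases hab : pos k = (a, b)
  · have hX := hA.apply_pos hpos k
    rw [hab] at hX ⊢
    simp only at hX
    simp [hX]
  have hsame : MvPolynomial.eval (Pi.single k (1 : F)) (A a b) =
      MvPolynomial.eval (0 : Fin n → F) (A a b) := by
    by_cases h : ∃ l, pos l = (a, b)
    · obtain ⟨l, hl⟩ := h
      have hX := hA.apply_pos hpos l
      have hlk : l ≠ k := by
        rintro rfl
        exact hab hl
      rw [hl] at hX
      simp only at hX
      simp [hX, hlk]
    · obtain ⟨c, hc⟩ := hA.exists_eq_C (not_exists.mp h)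
      simp [hc]
  by_cases ha : a = (pos k).1
  · have hb : b ≠ (pos k).2 := by
      rintro rfl
      exact hab (by rw [ha])
    subst ha
    simpa [hb] using hsame
  · simpa [updateRow_ne ha] using hsame

/-- The coefficient polynomial of `x_k` in an affine expression for the characteristic
polynomial has degree at most `n - 1 - (i_k - j_k)`. -/
theorem natDegree_coeff_le (hpos : IsHPos pos) (hA : IsULHSuperpatternOf A (HMat F pos))
    {P : F[X]} {q : Fin n → F[X]}
    (hchar : A.charpoly = P.map (MvPolynomial.C : F →+* MvPolynomial (Fin n) F) -
      ∑ k : Fin n, Polynomial.C (MvPolynomial.X k) *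
        (q k).map (MvPolynomial.C : F →+* MvPolynomial (Fin n) F)) (k : Fin n) :
    (q k).natDegree ≤ n - 1 - (((pos k).1 : ℕ) - ((pos k).2 : ℕ)) := by
  have heval : ∀ v : Fin n → F, (A.map (MvPolynomial.eval v)).charpoly =
      P - ∑ l, Polynomial.C (v l) * q l := by
    intro v
    have hcomp : (MvPolynomial.eval v).comp MvPolynomial.C = RingHom.id F := by
      ext c
      simp
    rw [charpoly_map, hchar]
    simp [Polynomial.map_sum, Polynomial.map_map, hcomp]
  have hdiff := natDegree_charpoly_sub_charpoly_updateRow_le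
    (A.map (MvPolynomial.eval (0 : Fin n → F)))
    (fun i j hij => by simp [hA.apply_eq_zero hpos hij]) (pos k).1 (pos k).2 (hpos.1 k)
  rw [← hA.map_eval_single hpos k, heval, heval] at hdiff
  simpa [Pi.single_apply, apply_ite Polynomial.C, ite_mul] using hdiff

end IsULHSuperpatternOf

/-- If a ULH superpattern `A` of `B_{(i₁,j₁),…,(iₙ,jₙ)} ∈ ℬ` is
PB-companion, then for every `k = 1,…,n` the variable `xₖ` lies strictly above the
`k`-subdiagonal: `iₖ − jₖ < k`. -/
theorem variable_above_subdiagonal_of_pbCompanion {F : Type*} [Field F] {n : ℕ}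
    (hn : 0 < n)
    (pos : Fin n → Fin n × Fin n) (hpos : IsBPos pos)
    (A : Matrix (Fin n) (Fin n) (MvPolynomial (Fin n) F))
    (hA : IsULHSuperpatternOf A (HMat F pos))
    (hPB : IsPBCompanion A) :
    ∀ k : Fin n, ((pos k).1 : ℕ) - ((pos k).2 : ℕ) < (k : ℕ) + 1 := by
  intro k
  by_contra! hk
  obtain ⟨-, p, -, hli, -, hchar⟩ := hPB
  have hlt := (pos k).1.isLt
  let e : Fin (n - k) → Fin (n + 1) := fun m => ⟨m, by omega⟩
  have he : Function.Injective e := fun a b h => Fin.ext (Fin.mk.inj h)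
  have hmem : ∀ m, p (e m) ∈ degreeLT F (n - k - 1) := by
    intro m
    have hm := m.isLt
    have hkl : k ≤ (⟨n - 1 - m, by omega⟩ : Fin n) := Fin.le_def.mpr (by simp only; omega)
    have hdeg := hA.natDegree_coeff_le hpos.1 hchar ⟨n - 1 - m, by omega⟩
    have hmono := hpos.1.sub_mono hkl
    have hidx : (⟨n - 1 - (n - 1 - (m : ℕ)), by omega⟩ : Fin (n + 1)) = e m :=
      Fin.ext (by simp only [e]; omega)
    simp only [hidx] at hdeg
    rw [mem_degreeLT]
    refine degree_le_natDegree.trans_lt (Nat.cast_lt.mpr ?_)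
    omega
  have hli' : LinearIndependent F fun m => (⟨p (e m), hmem m⟩ : degreeLT F (n - k - 1)) :=
    LinearIndependent.of_comp (degreeLT F (n - k - 1)).subtype (hli.comp e he)
  have : Module.Finite F (degreeLT F (n - k - 1)) :=
    Module.Finite.equiv (degreeLTEquiv F (n - k - 1)).symm
  have hcard := hli'.fintype_card_le_finrank
  rw [finrank_degreeLT, Fintype.card_fin] at hcard
  omega
end
end
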